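/- Let f ∈ ℝ[x_1,…,x_n], let d be an even positive integer with d ≥ deg f, let T be the Chebyshev polynomial of the first kind of degree d, and let q be the smallest prime number greater than n. Define g(x) = n + 1/q + ∑_{k=1}^{n} T(x_k)/(q − n − 1 + k). There exists a nonzero polynomial Q, with real coefficients, in the n² entries of an n×n matrix, such that every V ∈ ℚ^{n×n} with Q(V) ≠ 0 is invertible and has the following property. Write f̃(x) = f(Vx) and F(t,x) = (1−t) f̃(x) + t g(x). For every connected component C of any of the three sets {x ∈ ℝⁿ : f̃(x) = 0}, {x ∈ ℝⁿ : f̃(x) > 0}, {x ∈ ℝⁿ : f̃(x) < 0}, every z ∈ Z(C), and every ε > 0, there exist a real number t with 0 < |t| < ε and w ∈ ℝⁿ with ‖w − z‖ < ε such that F(t,w) = 0 and (∂F/∂x_i)(t,w) = 0 for all i = 2,…,n. -/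

import Mathlib

open MvPolynomial Set

/-- The projection `π_1` of a subset of `ℝⁿ` to its first coordinate. -/
def proj1 {n : ℕ} (hn : 0 < n) (A : Set (EuclideanSpace ℝ (Fin n))) : Set ℝ :=
  (fun x => x ⟨0, hn⟩) '' A

/-- `Z_inf(A)` with respect to the first coordinate. -/
def Zinf {n : ℕ} (hn : 0 < n) (A : Set (EuclideanSpace ℝ (Fin n))) :
    Set (EuclideanSpace ℝ (Fin n)) :=
  {x | x ∈ closure A ∧ BddBelow (proj1 hn A) ∧ x ⟨0, hn⟩ = sInf (proj1 hn A)}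

/-- `Z_sup(A)` with respect to the first coordinate. -/
def Zsup {n : ℕ} (hn : 0 < n) (A : Set (EuclideanSpace ℝ (Fin n))) :
    Set (EuclideanSpace ℝ (Fin n)) :=
  {x | x ∈ closure A ∧ BddAbove (proj1 hn A) ∧ x ⟨0, hn⟩ = sSup (proj1 hn A)}

/-- `Z(A) = Z_inf(A) ∪ Z_sup(A)`. -/
def ZZ {n : ℕ} (hn : 0 < n) (A : Set (EuclideanSpace ℝ (Fin n))) :
    Set (EuclideanSpace ℝ (Fin n)) :=
  Zinf hn A ∪ Zsup hn A

/-- `g(x) = n + 1/q + ∑_{k=1}^n T(x_k)/(q - n - 1 + k)` as a real polynomial,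
`T` the Chebyshev polynomial of the first kind of degree `d`. -/
noncomputable def gPoly (n d q : ℕ) : MvPolynomial (Fin n) ℝ :=
  C (n : ℝ) + C ((q : ℝ))⁻¹ +
    ∑ k : Fin n, C (((q - n - 1 + ((k : ℕ) + 1) : ℕ) : ℝ))⁻¹ *
      Polynomial.aeval (X k) (Polynomial.Chebyshev.T ℝ d)

/-- The polynomial `x ↦ p(Vx)`. -/
noncomputable def compMat {n : ℕ} (V : Matrix (Fin n) (Fin n) ℚ)
    (p : MvPolynomial (Fin n) ℝ) : MvPolynomial (Fin n) ℝ :=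
  aeval (fun j : Fin n => ∑ k : Fin n, C ((V j k : ℚ) : ℝ) * X k) p

/-- The deformation `F(t,·) = (1-t) f(V·) + t g`. -/
noncomputable def Fdef {n : ℕ} (d q : ℕ) (V : Matrix (Fin n) (Fin n) ℚ)
    (p : MvPolynomial (Fin n) ℝ) (t : ℝ) : MvPolynomial (Fin n) ℝ :=
  C (1 - t) * compMat V p + C t * gPoly n d q

section Analysis

open Metric Topology

/-- `z` is a zero of `h` that is a limit of points outside the zero set of `h` at which a multiple
of the differential of `h` approaches `ℓ`. -/
def NearCritical {E : Type*} [NormedAddCommGroup E] [NormedSpace ℝ E] (h : E → ℝ)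
    (ℓ : E →L[ℝ] ℝ) (z : E) : Prop :=
  h z = 0 ∧ ∀ ε > 0, ∃ y, dist y z < ε ∧ h y ≠ 0 ∧ ∃ c : ℝ, ‖c • fderiv ℝ h y - ℓ‖ < ε

/-- A point of a compact set whose connected component avoids a closed set `A` has an open
neighbourhood that cuts out a relatively clopen subset disjoint from `A`. -/
lemma IsCompact.exists_isOpen_of_disjoint_connectedComponentIn {X : Type*} [TopologicalSpace X]
    [T4Space X] {K A : Set X} (hK : IsCompact K) (hA : IsClosed A) {z : X} (hz : z ∈ K)
    (hzA : Disjoint (connectedComponentIn K z) A) :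
    ∃ U, IsOpen U ∧ z ∈ U ∧ closure U ∩ K ⊆ U ∧ Disjoint (U ∩ K) A := by
  have : CompactSpace K := isCompact_iff_compactSpace.mp hK
  have hA' : IsClosed ((↑) ⁻¹' A : Set K) := hA.preimage continuous_subtype_val
  obtain ⟨N, hN, hzN, hNA⟩ : ∃ N : Set K, IsClopen N ∧ ⟨z, hz⟩ ∈ N ∧
      Disjoint N ((↑) ⁻¹' A) := by
    have hcc := connectedComponent_eq_iInter_isClopen (⟨z, hz⟩ : K)
    have hdir : Directed (· ⊇ ·)
        (fun s : {s : Set K // IsClopen s ∧ ⟨z, hz⟩ ∈ s} => (s : Set K)) := fun s t =>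
      ⟨⟨s.1 ∩ t.1, s.2.1.inter t.2.1, s.2.2, t.2.2⟩, inter_subset_left, inter_subset_right⟩
    have : Nonempty {s : Set K // IsClopen s ∧ ⟨z, hz⟩ ∈ s} := ⟨⟨univ, isClopen_univ, trivial⟩⟩
    obtain ⟨s, hs⟩ := hA'.isCompact.elim_directed_family_closed _
      (fun s => s.2.1.isClosed) (by
        rw [← hcc, ← disjoint_iff_inter_eq_empty, Set.disjoint_left]
        intro x hxA hx
        refine Set.disjoint_left.mp hzA ?_ hxA
        rw [connectedComponentIn_eq_image hz]
        exact mem_image_of_mem _ hx) hdir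
    exact ⟨s.1, s.2.1, s.2.2, (disjoint_iff_inter_eq_empty.mpr hs).symm⟩
  have hN₁ : IsClosed ((↑) '' N : Set X) :=
    (hN.isClosed.isCompact.image continuous_subtype_val).isClosed
  have hN₂ : IsClosed ((↑) '' Nᶜ : Set X) :=
    (hN.compl.isClosed.isCompact.image continuous_subtype_val).isClosed
  obtain ⟨U, hU, hNU, hUN⟩ := normal_exists_closure_subset hN₁ hN₂.isOpen_compl (by
    rintro _ ⟨x, hx, rfl⟩ ⟨y, hy, hxy⟩
    exact hy (Subtype.val_injective hxy ▸ hx))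
  have key : ∀ x (hx : x ∈ K), x ∈ closure U → (⟨x, hx⟩ : K) ∈ N := fun x hx hxU => by
    by_contra hxN
    exact hUN hxU ⟨⟨x, hx⟩, hxN, rfl⟩
  refine ⟨U, hU, hNU ⟨_, hzN, rfl⟩, fun x hx => hNU ⟨_, key x hx.2 hx.1, rfl⟩, ?_⟩
  rw [Set.disjoint_left]
  exact fun x hx hxA => Set.disjoint_left.mp hNA (key x hx.2 (subset_closure hx.1)) hxA

lemma closure_connectedComponentIn_subset {X : Type*} [TopologicalSpace X] {P : Set X}
    {x₀ : X} (hx₀ : x₀ ∈ P) : closure (connectedComponentIn P x₀) ∩ P ⊆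
      connectedComponentIn P x₀ :=
  (isPreconnected_connectedComponentIn.subset_closure
    (subset_inter subset_closure (connectedComponentIn_subset P x₀))
    inter_subset_left).subset_connectedComponentIn
    ⟨subset_closure (mem_connectedComponentIn hx₀), hx₀⟩ inter_subset_right

lemma Set.Finite.exists_closedBall_inter_subset {X : Type*} [MetricSpace X]
    {Φ : Set X} (hΦ : Φ.Finite) (z : X) {ε : ℝ} (hε : 0 < ε) :
    ∃ r > 0, r < ε ∧ ∀ x ∈ Φ, dist x z ≤ r → x = z := by
  have hopen : IsOpen (Φ \ {z})ᶜ := (hΦ.subset sdiff_subset).isClosed.isOpen_compl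
  obtain ⟨r, hr, hrsub⟩ := Metric.isOpen_iff.mp hopen z (by simp)
  refine ⟨min r ε / 2, by positivity, ?_, fun x hx hxz => ?_⟩
  · linarith [min_le_right r ε]
  · by_contra hne
    refine hrsub (mem_ball.mpr (lt_of_le_of_lt hxz ?_)) ⟨hx, hne⟩
    linarith [min_le_left r ε, lt_min hr hε]

variable {E : Type*} [NormedAddCommGroup E] [InnerProductSpace ℝ E]

lemma NearCritical.neg_left {h : E → ℝ} {ℓ : E →L[ℝ] ℝ} {z : E}
    (H : NearCritical (fun x => -h x) ℓ z) : NearCritical h ℓ z := by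
  refine ⟨by simpa using H.1, fun ε hε => ?_⟩
  obtain ⟨y, hy, hy0, c, hc⟩ := H.2 ε hε
  refine ⟨y, hy, by simpa using hy0, -c, ?_⟩
  have : fderiv ℝ (fun x => -h x) y = -fderiv ℝ h y := fderiv_neg
  simpa [this] using hc

lemma NearCritical.neg_right {h : E → ℝ} {ℓ : E →L[ℝ] ℝ} {z : E}
    (H : NearCritical h (-ℓ) z) : NearCritical h ℓ z := by
  refine ⟨H.1, fun ε hε => ?_⟩
  obtain ⟨y, hy, hy0, c, hc⟩ := H.2 ε hε
  refine ⟨y, hy, hy0, -c, ?_⟩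
  rwa [← norm_neg, show -(-c • fderiv ℝ h y - ℓ) = c • fderiv ℝ h y - -ℓ by module]

lemma finite_nearCritical_neg {h : E → ℝ} {ℓ : E →L[ℝ] ℝ} (hfin : {z | NearCritical h ℓ z}.Finite) :
    {z | NearCritical h (-ℓ) z}.Finite :=
  hfin.subset fun _ hz => NearCritical.neg_right hz

/-- The linear form `ℓ`, recentred at `z` and made strictly convex. -/
lemma hasFDerivAt_add_norm_sq (ℓ : E →L[ℝ] ℝ) (z x : E) :
    HasFDerivAt (fun x => ℓ x - ℓ z + ‖x - z‖ ^ 2) (ℓ + 2 • innerSL ℝ (x - z)) x := by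
  have h1 : HasFDerivAt (fun x => ℓ x - ℓ z) ℓ x := ℓ.hasFDerivAt.sub_const _
  have h2 := ((hasFDerivAt_id x).sub_const z).norm_sq
  simpa using! h1.add h2

lemma norm_two_smul_innerSL_lt {x z : E} {δ : ℝ} (hx : dist x z < δ) :
    ‖(2 : ℕ) • innerSL ℝ (x - z)‖ < 2 * δ := by
  rw [← Nat.cast_smul_eq_nsmul ℝ, norm_smul, innerSL_apply_norm, ← dist_eq_norm]
  norm_num
  exact hx

variable [FiniteDimensional ℝ E]

/-- A linear form minimised over a sublevel set of `u` at an interior point forces `u` to vanish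
there together with its derivatives along the kernel of the form. -/
lemma eq_zero_and_fderiv_eq_zero_of_forall_le {u : E → ℝ} (hu : ContDiff ℝ 1 u)
    {ℓ : E →L[ℝ] ℝ} (hℓ : ℓ ≠ 0) {w : E} {O : Set E} (hO : IsOpen O) (hwO : w ∈ O) (hw : u w ≤ 0)
    (hmin : ∀ x ∈ O, u x ≤ 0 → ℓ w ≤ ℓ x) :
    u w = 0 ∧ ∀ k, ℓ k = 0 → fderiv ℝ u w k = 0 := by
  obtain ⟨e, he⟩ : ∃ e, ℓ e < 0 := by
    by_contra! hcon
    refine hℓ (ContinuousLinearMap.ext fun x => le_antisymm ?_ (hcon x))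
    simpa using hcon (-x)
  have h0 : u w = 0 := by
    by_contra hne
    have hlt : u w < 0 := lt_of_le_of_ne hw hne
    have hc : Continuous fun s : ℝ => w + s • e := by fun_prop
    have h1 : ∀ᶠ s : ℝ in 𝓝[>] 0, w + s • e ∈ O ∧ u (w + s • e) < 0 := by
      refine nhdsWithin_le_nhds ?_
      exact (hc.continuousAt.eventually_mem (hO.mem_nhds (by simpa using hwO))).and
        ((hu.continuous.comp hc).continuousAt.eventually_lt continuousAt_const (by simpa using hlt))
    obtain ⟨s, ⟨hsO, hs⟩, hs0⟩ := (h1.and self_mem_nhdsWithin).exists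
    have := hmin _ hsO hs.le
    simp only [map_add, map_smul, smul_eq_mul] at this
    nlinarith [mul_neg_of_pos_of_neg (show (0 : ℝ) < s from hs0) he]
  refine ⟨h0, fun k hk => ?_⟩
  have hloc : IsLocalExtrOn ℓ {x | u x = u w} w := by
    refine Or.inl ?_
    filter_upwards [self_mem_nhdsWithin, nhdsWithin_le_nhds (hO.mem_nhds hwO)] with x hx hxO
    exact hmin x hxO (hx.trans h0).le
  obtain ⟨a, b, hab, heq⟩ := hloc.exists_multipliers_of_hasStrictFDerivAt_1d
    (hu.contDiffAt.hasStrictFDerivAt one_ne_zero) ℓ.hasStrictFDerivAt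
  have hval : ∀ x, a * fderiv ℝ u w x + b * ℓ x = 0 := fun x => by
    simpa using congrArg (fun L : E →L[ℝ] ℝ => L x) heq
  rcases eq_or_ne a 0 with rfl | ha
  · have hb : b = 0 := by
      simpa [he.ne] using hval e
    exact absurd (by rw [hb]; rfl) hab
  · simpa [hk, ha] using hval k

/-- A point minimising `ℓ` over a connected component of a compact piece of the zero set of `h`. -/
lemma nearCritical_of_isMinOn_component {h : E → ℝ} (hh : ContDiff ℝ 1 h) {ℓ : E →L[ℝ] ℝ}
    (hℓ : ℓ ≠ 0) {p z : E} {r : ℝ} (hz : h z = 0) (hzr : z ∈ ball p r)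
    (hmin : ∀ x ∈ connectedComponentIn ({x | h x = 0} ∩ closedBall p r) z, ℓ z ≤ ℓ x) :
    NearCritical h ℓ z := by
  refine ⟨hz, fun ε hε => ?_⟩
  have hS : IsClosed {x | h x = 0} := isClosed_eq hh.continuous continuous_const
  obtain ⟨r', hr', hr'sub⟩ := Metric.isOpen_iff.mp isOpen_ball z hzr
  have hnℓ : 0 < ‖ℓ‖ := norm_pos_iff.mpr hℓ
  obtain ⟨δ, hδ, hδε, hδr, hδℓ⟩ : ∃ δ > 0, δ ≤ ε / 2 ∧ δ ≤ r' ∧ δ ≤ ‖ℓ‖ / 2 :=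
    ⟨min (ε / 2) (min r' (‖ℓ‖ / 2)), by positivity, by simp, by simp, by simp⟩
  set ψ : E → ℝ := fun x => ℓ x - ℓ z + ‖x - z‖ ^ 2 with hψ
  have hψc : Continuous ψ := by fun_prop
  have hK : IsCompact ({x | h x = 0} ∩ closedBall p r) :=
    (isCompact_closedBall p r).inter_left hS
  obtain ⟨U, hU, hzU, hUK, hUA⟩ := hK.exists_isOpen_of_disjoint_connectedComponentIn
    (A := {x | ψ x ≤ 0} ∩ (ball z δ)ᶜ)
    ((isClosed_le hψc continuous_const).inter isOpen_ball.isClosed_compl)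
    (z := z) ⟨hz, ball_subset_closedBall hzr⟩ (by
      rw [Set.disjoint_left]
      rintro x hx ⟨hx1, hx2⟩
      have h1 := hmin x hx
      have h2 : δ ≤ ‖x - z‖ := by simpa [dist_eq_norm] using hx2
      have h3 : ψ x ≤ 0 := hx1
      simp only [hψ] at h3
      nlinarith)
  have hW : IsCompact (closure U ∩ closedBall p r) :=
    (isCompact_closedBall p r).inter_left isClosed_closure
  have hzW : z ∈ closure U ∩ closedBall p r := ⟨subset_closure hzU, ball_subset_closedBall hzr⟩
  have hO : IsOpen (U ∩ ball z δ) := hU.inter isOpen_ball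
  have hT : IsCompact ((closure U ∩ closedBall p r) ∩ (U ∩ ball z δ)ᶜ ∩ {x | ψ x ≤ 0}) :=
    (hW.inter_right hO.isClosed_compl).inter_right (isClosed_le hψc continuous_const)
  obtain ⟨c, hc, hcT⟩ := hT.exists_forall_le' (f := fun x => h x ^ 2) (a := 0)
    (hh.continuous.pow 2).continuousOn (by
      rintro x ⟨⟨⟨hx1, hx2⟩, hx3⟩, hx4⟩
      have hne : h x ≠ 0 := fun h0 => by
        have hxU := hUK ⟨hx1, h0, hx2⟩
        refine hx3 ⟨hxU, ?_⟩
        by_contra hxb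
        exact Set.disjoint_left.mp hUA ⟨hxU, h0, hx2⟩ ⟨hx4, hxb⟩
      positivity)
  obtain ⟨m, hm⟩ := (hW.image hψc).bddBelow
  have hm' : ∀ x ∈ closure U ∩ closedBall p r, m ≤ ψ x := fun x hx => hm (mem_image_of_mem _ hx)
  set M : ℝ := (|m| + 1) / c with hM
  have hMc : M * c = |m| + 1 := by rw [hM]; field_simp
  have hMpos : 0 < M := by positivity
  obtain ⟨w, hwW, hw⟩ := hW.exists_isMinOn ⟨z, hzW⟩ (f := fun x => ψ x + M * h x ^ 2)
    (by have := hh.continuous; fun_prop)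
  have hwz : ψ w + M * h w ^ 2 ≤ 0 := by
    have := hw hzW
    simpa [hψ, hz] using this
  have hwO : w ∈ U ∩ ball z δ := by
    by_contra hcon
    have hψw : ψ w ≤ 0 := by nlinarith [mul_nonneg hMpos.le (sq_nonneg (h w))]
    have h1 := hcT w ⟨⟨hwW, hcon⟩, hψw⟩
    have h2 := mul_le_mul_of_nonneg_left h1 hMpos.le
    have h3 := hm' w hwW
    linarith [neg_abs_le m]
  have hOW : U ∩ ball z δ ⊆ closure U ∩ closedBall p r := fun x hx =>
    ⟨subset_closure hx.1, ball_subset_closedBall (hr'sub (ball_subset_ball hδr hx.2))⟩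
  have hloc : IsLocalMin (fun x => ψ x + M * h x ^ 2) w :=
    (hw.on_subset hOW).isLocalMin (hO.mem_nhds hwO)
  have hd := hloc.hasFDerivAt_eq_zero ((hasFDerivAt_add_norm_sq ℓ z w).add
    (((hh.differentiable one_ne_zero w).hasFDerivAt.pow 2).const_mul M))
  have hsmall := norm_two_smul_innerSL_lt hwO.2
  have heq : (-(2 * M * h w)) • fderiv ℝ h w - ℓ = 2 • innerSL ℝ (w - z) := by
    rw [← sub_eq_zero, ← neg_eq_zero, ← hd]
    ext k
    simp
    ring
  refine ⟨w, lt_of_lt_of_le hwO.2 (by linarith), fun h0 => ?_, -(2 * M * h w), ?_⟩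
  · rw [h0] at heq
    simp only [mul_zero, neg_zero, zero_smul, zero_sub] at heq
    rw [← heq, norm_neg] at hsmall
    linarith
  · rw [heq]
    linarith

/-- A point of the closure of a component of `{h > 0}` minimising `ℓ`. -/
lemma nearCritical_of_isMinOn_pos_component {h : E → ℝ} (hh : ContDiff ℝ 1 h) {ℓ : E →L[ℝ] ℝ}
    (hℓ : ℓ ≠ 0) {x₀ z : E} (hx₀ : 0 < h x₀)
    (hz : z ∈ closure (connectedComponentIn {x | 0 < h x} x₀))
    (hmin : ∀ x ∈ connectedComponentIn {x | 0 < h x} x₀, ℓ z ≤ ℓ x) :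
    NearCritical h ℓ z := by
  set C := connectedComponentIn {x | 0 < h x} x₀ with hC
  have hP : IsOpen {x | 0 < h x} := isOpen_lt continuous_const hh.continuous
  have hCo : IsOpen C := hP.connectedComponentIn
  have hcl : closure C ∩ {x | 0 < h x} ⊆ C := closure_connectedComponentIn_subset hx₀
  have hCP : C ⊆ {x | 0 < h x} := connectedComponentIn_subset _ _
  have hnonneg : ∀ x ∈ closure C, 0 ≤ h x := fun x hx =>
    closure_minimal (t := {x | 0 ≤ h x}) (fun y hy => (hCP hy).out.le)
      (isClosed_le continuous_const hh.continuous) hx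
  refine ⟨?_, fun ε hε => ?_⟩
  · by_contra hne
    have hzC : z ∈ C := hcl ⟨hz, lt_of_le_of_ne (hnonneg z hz) (Ne.symm hne)⟩
    have hloc : IsLocalMin ℓ z := by
      filter_upwards [hCo.mem_nhds hzC] with x hx using hmin x hx
    exact hℓ (hloc.hasFDerivAt_eq_zero ℓ.hasFDerivAt)
  set ψ : E → ℝ := fun x => ℓ x - ℓ z + ‖x - z‖ ^ 2 with hψ
  have hψc : Continuous ψ := by fun_prop
  set δ := ε / 2 with hδ
  have hδ0 : 0 < δ := by positivity
  have hψz : ψ z = 0 := by simp [hψ]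
  obtain ⟨y, ⟨hyδ, hyψ⟩, hyC⟩ := mem_closure_iff_nhds.mp hz
    (ball z δ ∩ {x | ψ x < δ ^ 2 / 2}) ((isOpen_ball.inter
      (isOpen_lt hψc continuous_const)).mem_nhds
        ⟨mem_ball_self hδ0, by simp only [mem_ofPred_eq, hψz]; positivity⟩)
  have hhy : 0 < h y := hCP hyC
  have hW : IsCompact (closure C ∩ closedBall z δ) :=
    (isCompact_closedBall z δ).inter_left isClosed_closure
  obtain ⟨B, hB⟩ := (hW.image hh.continuous).bddAbove
  have hB' : ∀ x ∈ closure C ∩ closedBall z δ, h x ≤ B := fun x hx => hB (mem_image_of_mem _ hx)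
  have hyW : y ∈ closure C ∩ closedBall z δ := ⟨subset_closure hyC, ball_subset_closedBall hyδ⟩
  have hBpos : 0 < B := hhy.trans_le (hB' y hyW)
  obtain ⟨M, hM0, hM⟩ : ∃ M > 0, B < h y * Real.exp (M * (δ ^ 2 / 2)) := by
    refine ⟨B / h y / (δ ^ 2 / 2), by positivity, ?_⟩
    rw [div_mul_cancel₀ _ (by positivity)]
    have := Real.add_one_lt_exp (x := B / h y) (by positivity)
    calc B = h y * (B / h y) := by field_simp
      _ < _ := by gcongr; linarith
  obtain ⟨w, hwW, hw⟩ := hW.exists_isMaxOn ⟨y, hyW⟩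
    (f := fun x => h x * Real.exp (-M * ψ x)) (by have := hh.continuous; fun_prop)
  have hwy : h y * Real.exp (-M * ψ y) ≤ h w * Real.exp (-M * ψ w) := hw hyW
  have hwpos : 0 < h w := by
    have : 0 < h w * Real.exp (-M * ψ w) := lt_of_lt_of_le (by positivity) hwy
    exact pos_of_mul_pos_left this (Real.exp_pos _).le
  have hwC : w ∈ C := hcl ⟨hwW.1, hwpos⟩
  have hwδ : w ∈ ball z δ := by
    by_contra hcon
    have h1 : δ ≤ ‖w - z‖ := by simpa [dist_eq_norm] using hcon
    have h2 : δ ^ 2 ≤ ψ w := by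
      have := hmin w hwC
      simp only [hψ]
      nlinarith
    have h3 : h w * Real.exp (-M * ψ w) ≤ B * Real.exp (-M * δ ^ 2) := by
      gcongr ?_ * Real.exp ?_
      · exact hB' w hwW
      · nlinarith
    have h4 : h y * Real.exp (-M * (δ ^ 2 / 2)) ≤ h y * Real.exp (-M * ψ y) := by
      gcongr h y * Real.exp ?_
      nlinarith [hyψ.out]
    have h5 : B * Real.exp (-M * δ ^ 2) < h y * Real.exp (-M * (δ ^ 2 / 2)) := by
      calc B * Real.exp (-M * δ ^ 2)
          < h y * Real.exp (M * (δ ^ 2 / 2)) * Real.exp (-M * δ ^ 2) := by gcongr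
        _ = _ := by rw [mul_assoc, ← Real.exp_add]; congr 2; ring
    linarith
  have hloc : IsLocalMax (fun x => h x * Real.exp (-M * ψ x)) w := by
    filter_upwards [(hCo.inter isOpen_ball).mem_nhds ⟨hwC, hwδ⟩] with x hx
    exact hw ⟨subset_closure hx.1, ball_subset_closedBall hx.2⟩
  have hd := hloc.hasFDerivAt_eq_zero ((hh.differentiable one_ne_zero w).hasFDerivAt.mul
    (((hasFDerivAt_add_norm_sq ℓ z w).const_mul (-M)).exp))
  have heq : (M * h w)⁻¹ • fderiv ℝ h w - ℓ = 2 • innerSL ℝ (w - z) := by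
    ext k
    have hk := congrArg (fun L : E →L[ℝ] ℝ => L k) hd
    have hk' : fderiv ℝ h w k - h w * M * (ℓ k + 2 * inner ℝ (w - z) k) = 0 := by
      refine (mul_eq_zero_iff_left (Real.exp_pos (-M * ψ w)).ne').mp (Eq.trans ?_ hk)
      simp only [hψ, add_apply, smul_apply, innerSL_apply_apply, smul_eq_mul, nsmul_eq_mul,
        Nat.cast_ofNat]
      ring
    simp only [sub_apply, smul_apply, innerSL_apply_apply, smul_eq_mul, nsmul_eq_mul,
      Nat.cast_ofNat]
    field_simp
    linarith
  refine ⟨w, lt_trans hwδ (by rw [hδ]; linarith), hwpos.ne', (M * h w)⁻¹, ?_⟩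
  rw [heq]
  have := norm_two_smul_innerSL_lt hwδ
  rw [hδ] at this
  linarith

lemma exists_perturbed_critical_of_pos_component {h g : E → ℝ} (hh : ContDiff ℝ 1 h)
    (hg : ContDiff ℝ 1 g) (hgpos : ∀ x, 0 < g x) {ℓ : E →L[ℝ] ℝ} (hℓ : ℓ ≠ 0)
    (hfin : {z | NearCritical h ℓ z}.Finite) {x₀ z : E} (hx₀ : 0 < h x₀)
    (hz : z ∈ closure (connectedComponentIn {x | 0 < h x} x₀))
    (hmin : ∀ x ∈ connectedComponentIn {x | 0 < h x} x₀, ℓ z ≤ ℓ x) {ε : ℝ} (hε : 0 < ε) :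
    ∃ s > 0, s < ε ∧ ∃ w, dist w z < ε ∧ h w = s * g w ∧
      ∀ k, ℓ k = 0 → fderiv ℝ h w k = s * fderiv ℝ g w k := by
  obtain ⟨r, hr, hrε, hrΦ⟩ := hfin.exists_closedBall_inter_subset z hε
  have hnear : ∀ x ∈ closure (connectedComponentIn {x | 0 < h x} x₀), ℓ x ≤ ℓ z →
      NearCritical h ℓ x := fun x hx hxz =>
    nearCritical_of_isMinOn_pos_component hh hℓ hx₀ hx fun y hy => hxz.trans (hmin y hy)
  set C := connectedComponentIn {x | 0 < h x} x₀ with hC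
  have hCo : IsOpen C := (isOpen_lt continuous_const hh.continuous).connectedComponentIn
  have hcl : closure C ∩ {x | 0 < h x} ⊆ C := closure_connectedComponentIn_subset hx₀
  have hCP : C ⊆ {x | 0 < h x} := connectedComponentIn_subset _ _
  have hW : IsCompact (closure C ∩ closedBall z r) :=
    (isCompact_closedBall z r).inter_left isClosed_closure
  obtain ⟨b, hb, hbT⟩ := (hW.inter_right (isClosed_sphere (x := z) (ε := r))).exists_forall_le'
    (f := ℓ) (a := ℓ z) ℓ.continuous.continuousOn (by
      rintro x ⟨⟨hx1, hx2⟩, hx3⟩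
      by_contra! hcon
      have hxz := hrΦ x (hnear x hx1 hcon) hx2
      rw [hxz, mem_sphere, dist_self] at hx3
      exact hr.ne hx3)
  obtain ⟨y, ⟨hyr, hyb⟩, hyC⟩ := mem_closure_iff_nhds.mp hz (ball z r ∩ {x | ℓ x < b})
    ((isOpen_ball.inter (isOpen_lt ℓ.continuous continuous_const)).mem_nhds
      ⟨mem_ball_self hr, hb⟩)
  have hyg : 0 < h y / g y := div_pos (hCP hyC) (hgpos y)
  obtain ⟨s, hs, hsε, hsy⟩ : ∃ s > 0, s < ε ∧ s ≤ h y / g y :=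
    ⟨min (ε / 2) (h y / g y), by positivity,
      lt_of_le_of_lt (min_le_left _ _) (by linarith), min_le_right _ _⟩
  have hu : ContDiff ℝ 1 fun x => s * g x - h x := (contDiff_const.mul hg).sub hh
  obtain ⟨w, ⟨⟨hwC, hwr⟩, hwu⟩, hw⟩ :=
    (hW.inter_right (isClosed_le hu.continuous continuous_const)).exists_isMinOn
    (s := (closure C ∩ closedBall z r) ∩ {x | s * g x - h x ≤ 0})
    ⟨y, ⟨subset_closure hyC, ball_subset_closedBall hyr⟩,
      sub_nonpos.mpr ((le_div_iff₀ (hgpos y)).mp hsy)⟩ ℓ.continuous.continuousOn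
  have hwy : ℓ w ≤ ℓ y := hw ⟨⟨subset_closure hyC, ball_subset_closedBall hyr⟩,
      sub_nonpos.mpr ((le_div_iff₀ (hgpos y)).mp hsy)⟩
  have hwball : w ∈ ball z r := by
    by_contra hcon
    have := hbT w ⟨⟨hwC, hwr⟩, le_antisymm hwr (not_lt.mp hcon)⟩
    exact absurd (hwy.trans_lt hyb) (not_lt.mpr this)
  have hwpos : 0 < h w := lt_of_lt_of_le (mul_pos hs (hgpos w)) (sub_nonpos.mp hwu)
  obtain ⟨h1, h2⟩ := eq_zero_and_fderiv_eq_zero_of_forall_le hu hℓ (hCo.inter isOpen_ball)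
    ⟨hcl ⟨hwC, hwpos⟩, hwball⟩ hwu fun x hx hxu =>
      hw ⟨⟨subset_closure hx.1, ball_subset_closedBall hx.2⟩, hxu⟩
  refine ⟨s, hs, hsε, w, hwball.out.trans hrε, by linarith, fun k hk => ?_⟩
  have h3 := h2 k hk
  rw [fderiv_fun_sub ((hg.differentiable one_ne_zero w).const_mul s)
    (hh.differentiable one_ne_zero w), fderiv_const_mul (hg.differentiable one_ne_zero w)] at h3
  simp only [sub_apply, smul_apply, smul_eq_mul] at h3
  linarith

lemma exists_perturbed_critical_of_pos_on_halfBall {h g : E → ℝ} (hh : ContDiff ℝ 1 h)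
    (hg : ContDiff ℝ 1 g) (hgpos : ∀ x, 0 < g x) {ℓ : E →L[ℝ] ℝ} (hℓ : ℓ ≠ 0) {z : E} {r ε : ℝ}
    (hr : 0 < r) (hrε : r < ε) (hz : h z = 0)
    (hpos : ∀ x ∈ closedBall z r, ℓ x ≤ ℓ z → x ≠ z → 0 < h x) :
    ∃ s > 0, s < ε ∧ ∃ w, dist w z < ε ∧ h w = s * g w ∧
      ∀ k, ℓ k = 0 → fderiv ℝ h w k = s * fderiv ℝ g w k := by
  obtain ⟨b, hb, hbT⟩ := ((isCompact_sphere z r).inter_right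
    (isClosed_le ℓ.continuous continuous_const)).exists_forall_le'
    (s := sphere z r ∩ {x | ℓ x ≤ ℓ z}) (f := fun x => h x / g x) (a := 0)
    (hh.continuous.div hg.continuous fun x => (hgpos x).ne').continuousOn (by
      rintro x ⟨hx1, hx2⟩
      exact div_pos (hpos x (sphere_subset_closedBall hx1) hx2
        (ne_of_mem_sphere hx1 hr.ne')) (hgpos x))
  obtain ⟨s, hs, hsε, hsb⟩ : ∃ s > 0, s < ε ∧ s < b :=
    ⟨min ε b / 2, by have := hr.trans hrε; positivity,
      by linarith [min_le_left ε b, lt_min (hr.trans hrε) hb],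
      by linarith [min_le_right ε b, lt_min (hr.trans hrε) hb]⟩
  have hu : ContDiff ℝ 1 fun x => h x - s * g x := hh.sub (contDiff_const.mul hg)
  have hzmem : z ∈ closedBall z r ∩ {x | h x - s * g x ≤ 0} :=
    ⟨mem_closedBall_self hr.le, by
      simpa [hz] using (mul_pos hs (hgpos z)).le⟩
  obtain ⟨w, ⟨hwr, hwu⟩, hw⟩ := ((isCompact_closedBall z r).inter_right
    (isClosed_le hu.continuous continuous_const)).exists_isMinOn ⟨z, hzmem⟩
    ℓ.continuous.continuousOn
  have hwball : w ∈ ball z r := by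
    by_contra hcon
    have := hbT w ⟨le_antisymm hwr (not_lt.mp hcon), hw hzmem⟩
    have h1 := (le_div_iff₀ (hgpos w)).mp this
    have h2 : h w - s * g w ≤ 0 := hwu
    nlinarith [hgpos w]
  obtain ⟨h1, h2⟩ := eq_zero_and_fderiv_eq_zero_of_forall_le hu hℓ isOpen_ball hwball hwu
    fun x hx hxu => hw ⟨ball_subset_closedBall hx, hxu⟩
  refine ⟨s, hs, hsε, w, hwball.out.trans hrε, by linarith, fun k hk => ?_⟩
  have h3 := h2 k hk
  rw [fderiv_fun_sub (hh.differentiable one_ne_zero w)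
    ((hg.differentiable one_ne_zero w).const_mul s),
    fderiv_const_mul (hg.differentiable one_ne_zero w)] at h3
  simp only [sub_apply, smul_apply, smul_eq_mul] at h3
  linarith

/-- Near a point minimising `ℓ` over a component of the zero set of `h`, the half space
`ℓ ≤ ℓ z` meets the zero set in that point only. -/
lemma exists_closedBall_zero_unique {h : E → ℝ} (hh : ContDiff ℝ 1 h) {ℓ : E →L[ℝ] ℝ}
    (hℓ : ℓ ≠ 0) (hfin : {z | NearCritical h ℓ z}.Finite) {x₀ z : E}
    (hz : z ∈ connectedComponentIn {x | h x = 0} x₀)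
    (hmin : ∀ x ∈ connectedComponentIn {x | h x = 0} x₀, ℓ z ≤ ℓ x) {ε : ℝ} (hε : 0 < ε) :
    ∃ r > 0, r < ε ∧ ∀ x ∈ closedBall z r, h x = 0 → ℓ x ≤ ℓ z → x = z := by
  obtain ⟨R, hR, hRε, hRΦ⟩ := hfin.exists_closedBall_inter_subset z hε
  have hz0 : z ∈ {x | h x = 0} := connectedComponentIn_subset _ _ hz
  have hS : IsClosed {x | h x = 0} := isClosed_eq hh.continuous continuous_const
  have hcomp : connectedComponentIn ({x | h x = 0} ∩ closedBall z R) z ⊆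
      connectedComponentIn {x | h x = 0} x₀ := by
    rw [connectedComponentIn_eq hz]
    exact connectedComponentIn_mono _ inter_subset_left
  have huniq : ∀ x ∈ connectedComponentIn ({x | h x = 0} ∩ closedBall z R) z,
      x ∈ ball z R → ℓ x ≤ ℓ z → x = z := fun x hx hxR hxz => by
    refine hRΦ x (nearCritical_of_isMinOn_component hh hℓ (p := z) (r := R)
      (connectedComponentIn_subset _ _ hx).1 hxR fun y hy => ?_) hxR.out.le
    rw [← connectedComponentIn_eq hx] at hy
    exact hxz.trans (hmin y (hcomp hy))
  set r := R / 2 with hr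
  have hr0 : 0 < r := by positivity
  have hrR : r < R := by rw [hr]; linarith
  have hK : IsCompact ({x | h x = 0} ∩ closedBall z r) :=
    (isCompact_closedBall z r).inter_left hS
  have hKR : {x | h x = 0} ∩ closedBall z r ⊆ {x | h x = 0} ∩ closedBall z R :=
    inter_subset_inter_right _ (closedBall_subset_closedBall hrR.le)
  have hzK : z ∈ {x | h x = 0} ∩ closedBall z r := ⟨hz0, mem_closedBall_self hr0.le⟩
  have huniq' : ∀ x ∈ connectedComponentIn ({x | h x = 0} ∩ closedBall z r) z,
      ℓ x ≤ ℓ z → x = z := fun x hx hxz =>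
    huniq x (connectedComponentIn_mono _ hKR hx)
      (closedBall_subset_ball hrR (connectedComponentIn_subset _ _ hx).2) hxz
  obtain ⟨U, hU, hzU, hUK, hUA⟩ := hK.exists_isOpen_of_disjoint_connectedComponentIn
    (A := sphere z r ∩ {x | ℓ x ≤ ℓ z})
    (isClosed_sphere.inter (isClosed_le ℓ.continuous continuous_const)) hzK (by
      rw [Set.disjoint_left]
      rintro x hx ⟨hx1, hx2⟩
      exact ne_of_mem_sphere hx1 hr0.ne' (huniq' x hx hx2))
  obtain ⟨ρ, hρ, hρU⟩ := Metric.isOpen_iff.mp (hU.inter isOpen_ball) z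
    ⟨hzU, mem_ball_self hr0⟩
  refine ⟨min ρ r / 2, by positivity,
    by linarith [min_le_right ρ r, lt_min hρ hr0], fun y hy hy0 hyz => ?_⟩
  have hyU : y ∈ U ∩ ball z r := hρU (closedBall_subset_ball
    (by linarith [min_le_left ρ r, lt_min hρ hr0]) hy)
  have hyK : y ∈ {x | h x = 0} ∩ closedBall z r := ⟨hy0, ball_subset_closedBall hyU.2⟩
  set D := connectedComponentIn ({x | h x = 0} ∩ closedBall z r) y with hD
  have hDK : D ⊆ {x | h x = 0} ∩ closedBall z r := connectedComponentIn_subset _ _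
  have hyD : y ∈ D := mem_connectedComponentIn hyK
  have hDU : D ⊆ U := isPreconnected_connectedComponentIn.subset_of_closure_inter_subset hU
    ⟨y, hyD, hyU.1⟩ fun x hx => hUK ⟨hx.1, hDK hx.2⟩
  have hDc : IsCompact D := hK.of_isClosed_subset (isClosed_of_closure_subset fun x hx =>
    closure_connectedComponentIn_subset hyK
      ⟨hx, hK.isClosed.closure_subset (closure_mono hDK hx)⟩) hDK
  obtain ⟨w, hwD, hw⟩ := hDc.exists_isMinOn ⟨y, hyD⟩ ℓ.continuous.continuousOn
  have hwz : ℓ w ≤ ℓ z := (hw hyD).trans hyz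
  have hwball : w ∈ ball z r := by
    by_contra hcon
    exact Set.disjoint_left.mp hUA ⟨hDU hwD, hDK hwD⟩
      ⟨le_antisymm (hDK hwD).2 (not_lt.mp hcon), hwz⟩
  have hwz' : w = z := hRΦ w (nearCritical_of_isMinOn_component hh hℓ (hDK hwD).1 hwball
    fun x hx => by
      rw [← connectedComponentIn_eq hwD] at hx
      exact hw hx) (hwball.out.le.trans hrR.le)
  refine huniq' y ?_ hyz
  rw [hwz'] at hwD
  exact connectedComponentIn_eq hwD ▸ hyD

lemma exists_perturbed_critical_of_zero_component {h g : E → ℝ} (hh : ContDiff ℝ 1 h)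
    (hg : ContDiff ℝ 1 g) (hgpos : ∀ x, 0 < g x) {ℓ : E →L[ℝ] ℝ} (hℓ : ℓ ≠ 0)
    (hfin : {z | NearCritical h ℓ z}.Finite) {x₀ z : E} (hx₀ : h x₀ = 0)
    (hz : z ∈ closure (connectedComponentIn {x | h x = 0} x₀))
    (hmin : ∀ x ∈ connectedComponentIn {x | h x = 0} x₀, ℓ z ≤ ℓ x) {ε : ℝ} (hε : 0 < ε) :
    ∃ s : ℝ, s ≠ 0 ∧ |s| < ε ∧ ∃ w, dist w z < ε ∧ h w = s * g w ∧
      ∀ k, ℓ k = 0 → fderiv ℝ h w k = s * fderiv ℝ g w k := by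
  have hS : IsClosed {x | h x = 0} := isClosed_eq hh.continuous continuous_const
  have hz' : z ∈ connectedComponentIn {x | h x = 0} x₀ :=
    closure_connectedComponentIn_subset (P := {x | h x = 0}) hx₀
      ⟨hz, hS.closure_subset (closure_mono (connectedComponentIn_subset _ _) hz)⟩
  have hz0 : z ∈ {x | h x = 0} := connectedComponentIn_subset _ _ hz'
  obtain ⟨r, hr, hrε, huniq⟩ := exists_closedBall_zero_unique hh hℓ hfin hz' hmin hε
  obtain ⟨e, he⟩ : ∃ e, ℓ e < 0 := by
    by_contra! hcon
    refine hℓ (ContinuousLinearMap.ext fun x => le_antisymm ?_ (hcon x))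
    simpa using hcon (-x)
  have hconv : Convex ℝ (ball z r ∩ {x | ℓ x < ℓ z}) :=
    (convex_ball z r).inter (convex_halfSpace_lt ℓ.isLinear _)
  have hne : ∀ x ∈ ball z r ∩ {x | ℓ x < ℓ z}, h x ≠ 0 := fun x hx hx0 => by
    have := huniq x (ball_subset_closedBall hx.1) hx0 hx.2.out.le
    exact absurd hx.2.out (by simp [this])
  -- the sign of `h` on the open half ball extends to the closed one, away from its centre
  have hext : ∀ φ : E → ℝ, Continuous φ → (∀ x, φ x = 0 → h x = 0) →
      (∀ x ∈ ball z r ∩ {x | ℓ x < ℓ z}, 0 ≤ φ x) →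
      ∀ x ∈ closedBall z (r / 2), ℓ x ≤ ℓ z → x ≠ z → 0 < φ x := by
    intro φ hφ hφ0 hφpos x hx hxz hxne
    refine lt_of_le_of_ne ?_ fun h0 => hxne (huniq x
      (closedBall_subset_closedBall (by linarith) hx) (hφ0 x h0.symm) hxz)
    have hc : Continuous fun s : ℝ => x + s • e := by fun_prop
    have hev : ∀ᶠ s : ℝ in 𝓝[>] 0, 0 ≤ φ (x + s • e) := by
      have hball : ∀ᶠ s : ℝ in 𝓝 0, x + s • e ∈ ball z r :=
        hc.continuousAt.eventually_mem (isOpen_ball.mem_nhds (by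
          simpa using closedBall_subset_ball (by linarith) hx))
      filter_upwards [nhdsWithin_le_nhds hball, self_mem_nhdsWithin] with s hs hs0
      refine hφpos _ ⟨hs, ?_⟩
      have : s * ℓ e < 0 := mul_neg_of_pos_of_neg hs0 he
      change ℓ (x + s • e) < ℓ z
      rw [map_add, map_smul, smul_eq_mul]
      linarith
    have hlim : Filter.Tendsto (fun s : ℝ => φ (x + s • e)) (𝓝[>] 0) (𝓝 (φ x)) := by
      have := (hφ.comp hc).tendsto 0
      simp only [Function.comp_apply, zero_smul, add_zero] at this
      exact this.mono_left nhdsWithin_le_nhds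
    exact ge_of_tendsto hlim hev
  have hsign : (∀ x ∈ ball z r ∩ {x | ℓ x < ℓ z}, 0 ≤ h x) ∨
      ∀ x ∈ ball z r ∩ {x | ℓ x < ℓ z}, 0 ≤ -h x := by
    by_contra! hcon
    obtain ⟨⟨x, hx, hx0⟩, y, hy, hy0⟩ := hcon
    obtain ⟨v, hv, hv0⟩ := hconv.isPreconnected.intermediate_value hx hy hh.continuous.continuousOn
      (show (0 : ℝ) ∈ Icc (h x) (h y) from ⟨hx0.le, by linarith⟩)
    exact hne v hv hv0
  rcases hsign with hsign | hsign
  · obtain ⟨s, hs, hsε, w, hw⟩ := exists_perturbed_critical_of_pos_on_halfBall hh hg hgpos hℓ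
      (half_pos hr) (show r / 2 < ε by linarith) hz0 (hext h hh.continuous (fun _ => id) hsign)
    exact ⟨s, hs.ne', by rwa [abs_of_pos hs], w, hw⟩
  · obtain ⟨s, hs, hsε, w, hw, hw0, hwk⟩ := exists_perturbed_critical_of_pos_on_halfBall hh.neg hg
      hgpos hℓ (half_pos hr) (show r / 2 < ε by linarith) (by simpa using hz0)
      (hext (fun x => -h x) hh.continuous.neg (by simp) hsign)
    refine ⟨-s, by simpa using hs.ne', by rwa [abs_neg, abs_of_pos hs], w, hw, by linarith,
      fun k hk => ?_⟩
    have := hwk k hk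
    rw [fderiv_fun_neg, neg_apply] at this
    linarith

/-- Points minimising a linear form over a component of a sign condition on `h` are limits of
critical points of the form on the perturbed level sets `h = s * g`. -/
theorem exists_perturbed_critical {h g : E → ℝ} (hh : ContDiff ℝ 1 h)
    (hg : ContDiff ℝ 1 g) (hgpos : ∀ x, 0 < g x) {ℓ : E →L[ℝ] ℝ} (hℓ : ℓ ≠ 0)
    (hfin : {z | NearCritical h ℓ z}.Finite) {P : Set E}
    (hP : P = {x | h x = 0} ∨ P = {x | 0 < h x} ∨ P = {x | h x < 0}) {x₀ z : E} (hx₀ : x₀ ∈ P)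
    (hz : z ∈ closure (connectedComponentIn P x₀))
    (hmin : ∀ x ∈ connectedComponentIn P x₀, ℓ z ≤ ℓ x) {ε : ℝ} (hε : 0 < ε) :
    ∃ s : ℝ, s ≠ 0 ∧ |s| < ε ∧ ∃ w, dist w z < ε ∧ h w = s * g w ∧
      ∀ k, ℓ k = 0 → fderiv ℝ h w k = s * fderiv ℝ g w k := by
  rcases hP with rfl | rfl | rfl
  · exact exists_perturbed_critical_of_zero_component hh hg hgpos hℓ hfin hx₀ hz hmin hε
  · obtain ⟨s, hs, hsε, w, hw⟩ := exists_perturbed_critical_of_pos_component hh hg hgpos hℓ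
      hfin hx₀ hz hmin hε
    exact ⟨s, hs.ne', by rwa [abs_of_pos hs], w, hw⟩
  · have hset : {x | h x < 0} = {x | 0 < -h x} := by simp
    rw [hset] at hx₀ hz hmin
    obtain ⟨s, hs, hsε, w, hw, hw0, hwk⟩ := exists_perturbed_critical_of_pos_component
      (h := fun x => -h x) hh.neg hg hgpos hℓ (hfin.subset fun z hz => hz.neg_left) hx₀ hz hmin hε
    refine ⟨-s, by simpa using hs.ne', by rwa [abs_neg, abs_of_pos hs], w, hw, by linarith,
      fun k hk => ?_⟩
    have := hwk k hk
    rw [fderiv_fun_neg, neg_apply] at this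
    linarith

end Analysis

section Algebra

/-- Pairs `(y, u)` with `f y ≠ 0` and `u` a multiple of the gradient of `f` at `y`. -/
def gradientPairs {n : ℕ} (f : MvPolynomial (Fin n) ℝ) : Set ((Fin n → ℝ) × (Fin n → ℝ)) :=
  {p | eval p.1 f ≠ 0 ∧ ∃ c : ℝ, ∀ i, p.2 i = c * eval p.1 (pderiv i f)}

lemma exists_ne_zero_aeval_eq_zero {n : ℕ}
    (a : Option (Option (Fin n)) → MvPolynomial (Option (Fin n)) ℝ) :
    ∃ P : MvPolynomial (Option (Option (Fin n))) ℝ, P ≠ 0 ∧ aeval a P = 0 := by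
  by_contra! hcon
  have hind : AlgebraicIndependent ℝ a := algebraicIndependent_iff.mpr fun p hp => by
    by_contra hne
    exact hcon p hne hp
  have hle := hind.lift_cardinalMk_le_trdeg
  rw [MvPolynomial.trdeg_of_isDomain] at hle
  simp only [Cardinal.mk_fintype, Fintype.card_option, Fintype.card_fin, Cardinal.lift_natCast,
    Nat.cast_le] at hle
  omega

/-- Over a generic covector `v`, limits of points outside the zero set of `f` with gradient
direction tending to `v` have only finitely many possible values of each coordinate on the zero
set. -/
lemma exists_coordinate_polynomial {n : ℕ} (f : MvPolynomial (Fin n) ℝ) (j : Fin n) :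
    ∃ L : MvPolynomial (Fin n) ℝ, L ≠ 0 ∧ ∀ v, eval v L ≠ 0 → ∃ r : Polynomial ℝ, r ≠ 0 ∧
      ∀ z, eval z f = 0 → (z, v) ∈ closure (gradientPairs f) → r.eval (z j) = 0 := by
  obtain ⟨P, hP, hPa⟩ := exists_ne_zero_aeval_eq_zero fun o : Option (Option (Fin n)) =>
    o.elim (rename some f) fun o' => o'.elim (X (some j)) fun i =>
      X none * rename some (pderiv i f)
  have hPP : optionEquivLeft ℝ _ P ≠ 0 := by simpa using hP
  obtain ⟨q, hq, hnd⟩ := Polynomial.exists_eq_pow_rootMultiplicity_mul_and_not_dvd _ hPP 0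
  rw [map_zero, sub_zero, Polynomial.X_dvd_iff] at hnd
  rw [map_zero, sub_zero] at hq
  have hR : optionEquivLeft ℝ _ (q.coeff 0) ≠ 0 := by simpa using hnd
  refine ⟨_, Polynomial.leadingCoeff_ne_zero.mpr hR, fun v hv =>
    ⟨(optionEquivLeft ℝ _ (q.coeff 0)).map (eval v), fun h0 => hv ?_, fun z hz hzv => ?_⟩⟩
  · have hcoeff := congrArg
      (fun p : Polynomial ℝ => p.coeff (optionEquivLeft ℝ _ (q.coeff 0)).natDegree) h0
    rwa [Polynomial.coeff_map, Polynomial.coeff_zero] at hcoeff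
  rw [← optionEquivLeft_elim_eval]
  have hcont : Continuous fun p : (Fin n → ℝ) × (Fin n → ℝ) =>
      eval (fun o : Option (Option (Fin n)) => o.elim (eval p.1 f) fun o' => o'.elim (p.1 j) p.2)
        ((optionEquivLeft ℝ _).symm q) := by
    refine (MvPolynomial.continuous_eval _).comp (continuous_pi ?_)
    rintro (_ | _ | i)
    · exact (MvPolynomial.continuous_eval f).comp continuous_fst
    · exact (continuous_apply j).comp continuous_fst
    · exact (continuous_apply i).comp continuous_snd
  suffices hzero : ∀ p ∈ gradientPairs f,
      eval (fun o : Option (Option (Fin n)) => o.elim (eval p.1 f) fun o' => o'.elim (p.1 j) p.2)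
        ((optionEquivLeft ℝ _).symm q) = 0 by
    have h1 : eval _ _ = (0 : ℝ) :=
      closure_minimal hzero (isClosed_singleton.preimage hcont) hzv
    rw [optionEquivLeft_elim_eval, AlgEquiv.apply_symm_apply] at h1
    simpa [hz, ← Polynomial.coeff_zero_eq_eval_zero] using h1
  · rintro p ⟨hpf, c, hc⟩
    have h1 := congrArg (eval fun o : Option (Fin n) => o.elim c p.1) hPa
    rw [← coe_aeval_eq_eval, map_zero] at h1
    change (aeval _) ((aeval _) P) = _ at h1
    rw [← AlgHom.comp_apply, comp_aeval] at h1
    have h2 : (fun o : Option (Option (Fin n)) => aeval (fun o : Option (Fin n) => o.elim c p.1)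
        (o.elim (rename some f) fun o' => o'.elim (X (some j)) fun i =>
          X none * rename some (pderiv i f) : MvPolynomial (Option (Fin n)) ℝ)) =
        fun o => o.elim (eval p.1 f) fun o' => o'.elim (p.1 j) p.2 := by
      funext o
      rcases o with _ | _ | i
      · simp [aeval_rename, Function.comp_def]
      · simp
      · simp [eval_rename, Function.comp_def, hc i]
    rw [h2] at h1
    rw [optionEquivLeft_elim_eval, AlgEquiv.apply_symm_apply]
    change eval _ _ = (0 : ℝ) at h1
    rw [optionEquivLeft_elim_eval, hq, Polynomial.map_mul, Polynomial.map_pow,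
      Polynomial.map_X, Polynomial.eval_mul, Polynomial.eval_pow, Polynomial.eval_X] at h1
    exact (mul_eq_zero.mp h1).resolve_left (pow_ne_zero _ hpf)

lemma eval_compMat {n : ℕ} (V : Matrix (Fin n) (Fin n) ℚ) (f : MvPolynomial (Fin n) ℝ)
    (x : Fin n → ℝ) :
    eval x (compMat V f) = eval ((V.map fun a : ℚ => (a : ℝ)).mulVec x) f := by
  rw [compMat, ← coe_aeval_eq_eval, ← coe_aeval_eq_eval]
  change (aeval x) ((aeval _) f) = (aeval _) f
  rw [← AlgHom.comp_apply, comp_aeval]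
  congr 2
  funext i
  simp [Matrix.mulVec, dotProduct]

lemma pderiv_aeval {n : ℕ} (g : Fin n → MvPolynomial (Fin n) ℝ) (k : Fin n)
    (f : MvPolynomial (Fin n) ℝ) :
    pderiv k (aeval g f) = ∑ i, aeval g (pderiv i f) * pderiv k (g i) := by
  induction f using MvPolynomial.induction_on with
  | C a => simp
  | add p q hp hq => simp only [map_add, hp, hq, add_mul, Finset.sum_add_distrib]
  | mul_X p i hp =>
    have hX : ∀ j, aeval g (pderiv j (X i : MvPolynomial (Fin n) ℝ)) = if j = i then 1 else 0 :=
      fun j => by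
        rw [pderiv_X, Pi.single_apply]
        split_ifs <;> simp_all
    simp only [map_mul, map_add, aeval_X, pderiv_mul, hp, hX, add_mul, Finset.sum_add_distrib,
      Finset.sum_mul, mul_ite, mul_one, mul_zero, ite_mul, zero_mul, Finset.sum_ite_eq',
      Finset.mem_univ, if_true]
    congr 1
    exact Finset.sum_congr rfl fun j _ => by ring

lemma eval_pderiv_compMat {n : ℕ} (V : Matrix (Fin n) (Fin n) ℚ) (f : MvPolynomial (Fin n) ℝ)
    (x : Fin n → ℝ) (k : Fin n) :
    eval x (pderiv k (compMat V f)) =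
      ∑ i, eval ((V.map fun a : ℚ => (a : ℝ)).mulVec x) (pderiv i f) * V i k := by
  rw [compMat, pderiv_aeval, map_sum]
  refine Finset.sum_congr rfl fun i _ => ?_
  rw [map_mul, ← eval_compMat, compMat]
  congr 1
  simp [pderiv_X, Pi.single_apply]

/-- Linear changes of coordinates transport limits of gradient pairs. -/
lemma mem_closure_gradientPairs_of_compMat {n : ℕ} {V : Matrix (Fin n) (Fin n) ℚ}
    {f : MvPolynomial (Fin n) ℝ} {z : Fin n → ℝ} {i₀ : Fin n} (c : ℝ)
    (hz : (z, Pi.single i₀ 1) ∈ closure (gradientPairs (compMat V f))) :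
    ((V.map fun a : ℚ => (a : ℝ)).mulVec z,
      fun i => c * (V.map fun a : ℚ => (a : ℝ)).adjugate i₀ i) ∈ closure (gradientPairs f) := by
  set A : Matrix (Fin n) (Fin n) ℝ := V.map fun a : ℚ => (a : ℝ) with hA
  have hcont : Continuous fun p : (Fin n → ℝ) × (Fin n → ℝ) =>
      (A.mulVec p.1, c • A.adjugate.transpose.mulVec p.2) := by fun_prop
  convert map_mem_closure hcont hz fun p hp => ?_ using 2
  · funext i
    simp
  · obtain ⟨hp, b, hb⟩ := hp
    refine ⟨by rwa [eval_compMat] at hp, c * b * A.det, fun i => ?_⟩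
    have h1 : p.2 = b • A.transpose.mulVec (fun i => eval (A.mulVec p.1) (pderiv i f)) := by
      funext k
      rw [hb k, eval_pderiv_compMat]
      simp [Matrix.mulVec, dotProduct, hA, mul_comm]
    have h2 : A.adjugate.transpose * A.transpose = A.det • 1 := by
      rw [← Matrix.transpose_mul, Matrix.mul_adjugate]
      simp
    simp only [h1, Matrix.mulVec_smul, Matrix.mulVec_mulVec, h2, Matrix.smul_mulVec,
      Matrix.one_mulVec, Pi.smul_apply, smul_eq_mul]
    ring

lemma exists_adjugate_row {n : ℕ} (i₀ : Fin n) {v : Fin n → ℝ} (hv : v i₀ ≠ 0) :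
    ∃ (c : ℝ) (A : Matrix (Fin n) (Fin n) ℝ), ∀ i, c * A.adjugate i₀ i = v i := by
  set M : Matrix (Fin n) (Fin n) ℝ := (1 : Matrix (Fin n) (Fin n) ℝ).updateRow i₀ v with hM
  have hdet : M.det = v i₀ := by
    rw [hM, ← Matrix.cramer_transpose_apply]
    simp
  have hunit : IsUnit M.det := by rw [hdet]; exact hv.isUnit
  refine ⟨M.det, M⁻¹, fun i => ?_⟩
  have h1 : (M⁻¹).adjugate = (M⁻¹).det • M := by
    calc (M⁻¹).adjugate = (M⁻¹).adjugate * M⁻¹ * M := by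
          rw [mul_assoc, Matrix.nonsing_inv_mul _ hunit, mul_one]
      _ = _ := by rw [Matrix.adjugate_mul, Matrix.smul_mul, one_mul]
  rw [h1, Matrix.smul_apply, smul_eq_mul, ← mul_assoc, Matrix.det_nonsing_inv,
    Ring.mul_inverse_cancel _ hunit, one_mul, hM, Matrix.updateRow_self]

/-- After a generic linear change of coordinates, only finitely many zeros of a polynomial are
limits of gradient pairs in the direction of a fixed coordinate. -/
theorem exists_generic_finite {n : ℕ} (i₀ : Fin n) (f : MvPolynomial (Fin n) ℝ) :
    ∃ Q : MvPolynomial (Fin n × Fin n) ℝ, Q ≠ 0 ∧ ∀ V : Matrix (Fin n) (Fin n) ℚ,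
      eval (fun ij => ((V ij.1 ij.2 : ℚ) : ℝ)) Q ≠ 0 → IsUnit V ∧
        {z : Fin n → ℝ | eval z (compMat V f) = 0 ∧
          (z, Pi.single i₀ 1) ∈ closure (gradientPairs (compMat V f))}.Finite := by
  choose L hL hLr using exists_coordinate_polynomial f
  have hpt : ∀ j, ∃ (c : ℝ) (A : Matrix (Fin n) (Fin n) ℝ),
      eval (fun i => c * A.adjugate i₀ i) (L j) ≠ 0 := fun j => by
    have hne : L j * X i₀ ≠ 0 := mul_ne_zero (hL j) (X_ne_zero i₀)
    obtain ⟨v, hv⟩ : ∃ v, eval v (L j * X i₀) ≠ 0 := by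
      by_contra! hcon
      exact hne (MvPolynomial.funext fun v => by simpa using hcon v)
    rw [map_mul, eval_X] at hv
    obtain ⟨c, A, hcA⟩ := exists_adjugate_row i₀ (right_ne_zero_of_mul hv)
    exact ⟨c, A, by simpa only [hcA] using left_ne_zero_of_mul hv⟩
  choose c A hcA using hpt
  have heval : ∀ (B : Matrix (Fin n) (Fin n) ℝ) j, eval (fun ij => B ij.1 ij.2)
      (aeval (fun i => C (c j) * (Matrix.mvPolynomialX (Fin n) (Fin n) ℝ).adjugate i₀ i) (L j)) =
      eval (fun i => c j * B.adjugate i₀ i) (L j) := fun B j => by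
    have hadj : ∀ i, eval (fun ij : Fin n × Fin n => B ij.1 ij.2)
        ((Matrix.mvPolynomialX (Fin n) (Fin n) ℝ).adjugate i₀ i) = B.adjugate i₀ i := fun i => by
      have := RingHom.map_adjugate (eval fun ij : Fin n × Fin n => B ij.1 ij.2)
        (Matrix.mvPolynomialX (Fin n) (Fin n) ℝ)
      rw [Matrix.mvPolynomialX_mapMatrix_eval] at this
      rw [← this]
      rfl
    rw [← coe_aeval_eq_eval, ← coe_aeval_eq_eval]
    change (aeval _) ((aeval _) (L j)) = (aeval _) (L j)
    rw [← AlgHom.comp_apply, comp_aeval]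
    congr 2
    funext i
    simp [← hadj]
  refine ⟨(Matrix.mvPolynomialX (Fin n) (Fin n) ℝ).det * ∏ j, aeval (fun i => C (c j) *
    (Matrix.mvPolynomialX (Fin n) (Fin n) ℝ).adjugate i₀ i) (L j),
    mul_ne_zero (Matrix.det_mvPolynomialX_ne_zero _ _) (Finset.prod_ne_zero_iff.mpr
      fun j _ h0 => hcA j ?_), fun V hV => ?_⟩
  · rw [← heval, h0, map_zero]
  rw [map_mul, map_prod, Matrix.eval_det_mvPolynomialX] at hV
  have hdet : (V.map fun a : ℚ => (a : ℝ)).det ≠ 0 := left_ne_zero_of_mul hV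
  have hdetQ : V.det ≠ 0 := fun h0 => hdet (by
    have := RingHom.map_det (Rat.castHom ℝ) V
    rw [h0, map_zero] at this
    exact this.symm)
  have hLV : ∀ j, eval (fun i => c j * (V.map fun a : ℚ => (a : ℝ)).adjugate i₀ i) (L j) ≠ 0 :=
    fun j => by
      rw [← heval]
      exact Finset.prod_ne_zero_iff.mp (right_ne_zero_of_mul hV) j (Finset.mem_univ j)
  refine ⟨(Matrix.isUnit_iff_isUnit_det V).mpr hdetQ.isUnit, ?_⟩
  choose r hr hrz using fun j => hLr j _ (hLV j)
  have hinj : Function.Injective (V.map fun a : ℚ => (a : ℝ)).mulVec :=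
    Matrix.mulVec_injective_iff_isUnit.mpr ((Matrix.isUnit_iff_isUnit_det _).mpr hdet.isUnit)
  refine Finite.of_finite_image ?_ hinj.injOn
  refine (Finite.pi' fun j => (r j).roots.toFinset.finite_toSet).subset ?_
  rintro _ ⟨z, ⟨hz0, hz⟩, rfl⟩ j
  rw [eval_compMat] at hz0
  simpa [hr j] using hrz j _ hz0 (mem_closure_gradientPairs_of_compMat (c j) hz)

end Algebra

section PolynomialFunctions

variable {n : ℕ}

lemma hasFDerivAt_eval (p : MvPolynomial (Fin n) ℝ) (x : EuclideanSpace ℝ (Fin n)) :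
    HasFDerivAt (fun x : EuclideanSpace ℝ (Fin n) => eval (fun j => x j) p)
      (∑ k, eval (fun j => x j) (pderiv k p) • EuclideanSpace.proj (𝕜 := ℝ) k) x := by
  induction p using MvPolynomial.induction_on with
  | C a => simpa using hasFDerivAt_const a x
  | add p q hp hq =>
    simp only [map_add, add_smul, Finset.sum_add_distrib]
    exact hp.add hq
  | mul_X p i hp =>
    have hi : HasFDerivAt (fun x : EuclideanSpace ℝ (Fin n) => x i)
        (EuclideanSpace.proj (𝕜 := ℝ) i) x := (EuclideanSpace.proj (𝕜 := ℝ) i).hasFDerivAt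
    simp only [map_mul, eval_X]
    refine (hp.mul hi).congr_fderiv (Eq.symm ?_)
    simp only [pderiv_mul, map_add, map_mul, eval_X, add_smul, Finset.sum_add_distrib,
      Finset.smul_sum, smul_smul, pderiv_X, Pi.single_apply]
    rw [add_comm]
    congr 1
    · rw [Finset.sum_eq_single i]
      · simp
      · intro k _ hk
        simp [hk.symm]
      · simp
    · exact Finset.sum_congr rfl fun k _ => by rw [mul_comm]

lemma fderiv_eval_single (p : MvPolynomial (Fin n) ℝ) (x : EuclideanSpace ℝ (Fin n)) (k : Fin n) :
    fderiv ℝ (fun x : EuclideanSpace ℝ (Fin n) => eval (fun j => x j) p) x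
      (EuclideanSpace.single k 1) = eval (fun j => x j) (pderiv k p) := by
  rw [(hasFDerivAt_eval p x).fderiv]
  simp

lemma contDiff_eval (p : MvPolynomial (Fin n) ℝ) :
    ContDiff ℝ 1 fun x : EuclideanSpace ℝ (Fin n) => eval (fun j => x j) p := by
  induction p using MvPolynomial.induction_on with
  | C a => simpa using contDiff_const
  | add p q hp hq => simpa only [map_add] using hp.add hq
  | mul_X p i hp =>
    simp only [map_mul, eval_X]
    exact hp.mul (EuclideanSpace.proj (𝕜 := ℝ) i).contDiff

lemma NearCritical.mem_closure_gradientPairs {p : MvPolynomial (Fin n) ℝ} {i₀ : Fin n}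
    {z : EuclideanSpace ℝ (Fin n)}
    (H : NearCritical (fun x : EuclideanSpace ℝ (Fin n) => eval (fun j => x j) p)
      (EuclideanSpace.proj i₀) z) :
    ((fun j => z j), Pi.single i₀ 1) ∈ closure (gradientPairs p) := by
  rw [Metric.mem_closure_iff]
  intro ε hε
  obtain ⟨y, hy, hy0, c, hc⟩ := H.2 ε hε
  refine ⟨(fun j => y j, fun i => c * eval (fun j => y j) (pderiv i p)), ⟨hy0, c, fun i => rfl⟩, ?_⟩
  rw [Prod.dist_eq, max_lt_iff, dist_pi_lt_iff hε, dist_pi_lt_iff hε]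
  refine ⟨fun j => ?_, fun i => ?_⟩
  · rw [dist_comm, dist_eq_norm]
    rw [dist_eq_norm] at hy
    exact (PiLp.norm_apply_le (y - z) j).trans_lt hy
  · have hle := (c • fderiv ℝ (fun x : EuclideanSpace ℝ (Fin n) => eval (fun j => x j) p) y -
      EuclideanSpace.proj i₀).le_opNorm (EuclideanSpace.single i 1)
    rw [PiLp.norm_single, norm_one, mul_one] at hle
    rw [dist_comm, dist_eq_norm]
    refine lt_of_eq_of_lt ?_ (hle.trans_lt hc)
    simp [fderiv_eval_single, Pi.single_apply, eq_comm]

lemma finite_nearCritical {p : MvPolynomial (Fin n) ℝ} {i₀ : Fin n}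
    (hfin : {z : Fin n → ℝ | eval z p = 0 ∧
      (z, Pi.single i₀ 1) ∈ closure (gradientPairs p)}.Finite) :
    {z | NearCritical (fun x : EuclideanSpace ℝ (Fin n) => eval (fun j => x j) p)
      (EuclideanSpace.proj i₀) z}.Finite := by
  refine (hfin.preimage (f := fun (z : EuclideanSpace ℝ (Fin n)) j => z j)
    fun x _ y _ hxy => ?_).subset fun z hz => ⟨hz.1, hz.mem_closure_gradientPairs⟩
  ext j
  exact congrFun hxy j

lemma neg_one_le_eval_T {d : ℕ} (hd : Even d) (x : ℝ) :
    -1 ≤ (Polynomial.Chebyshev.T ℝ d).eval x := by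
  rcases le_total |x| 1 with hx | hx
  · exact (abs_le.mp (Polynomial.Chebyshev.abs_eval_T_real_le_one d hx)).1
  rcases le_abs.mp hx with hx | hx
  · linarith [Polynomial.Chebyshev.one_le_eval_T_real d hx]
  · have h1 := Polynomial.Chebyshev.one_le_negOnePow_mul_eval_T_real d (le_neg_of_le_neg hx)
    rw [Int.negOnePow_even _ ((Int.even_coe_nat d).mpr hd)] at h1
    simp only [Units.val_one, Int.cast_one, one_mul] at h1
    linarith

lemma eval_gPoly_pos {d q : ℕ} (hd : Even d) (hq : 0 < q) (x : Fin n → ℝ) :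
    0 < eval x (gPoly n d q) := by
  have hT : ∀ k, eval x (Polynomial.aeval (X k) (Polynomial.Chebyshev.T ℝ d)) =
      (Polynomial.Chebyshev.T ℝ d).eval (x k) := fun k => by
    rw [← coe_aeval_eq_eval]
    change aeval x (Polynomial.aeval _ _) = _
    rw [← Polynomial.aeval_algHom_apply, aeval_X, Polynomial.coe_aeval_eq_eval]
  have hterm : ∀ k : Fin n, (-1 : ℝ) ≤ (((q - n - 1 + ((k : ℕ) + 1) : ℕ) : ℝ))⁻¹ *
      (Polynomial.Chebyshev.T ℝ d).eval (x k) := fun k => by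
    have h1 : (1 : ℝ) ≤ ((q - n - 1 + ((k : ℕ) + 1) : ℕ) : ℝ) := by
      exact_mod_cast Nat.le_add_left 1 _
    have h2 := inv_le_one_of_one_le₀ h1
    have h3 : 0 ≤ (((q - n - 1 + ((k : ℕ) + 1) : ℕ) : ℝ))⁻¹ := by positivity
    nlinarith [neg_one_le_eval_T hd (x k)]
  have hsum := Finset.sum_le_sum fun k (_ : k ∈ Finset.univ) => hterm k
  have hqinv : (0 : ℝ) < (q : ℝ)⁻¹ := by positivity
  simp only [gPoly, map_add, map_sum, map_mul, eval_C, hT]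
  simp only [Finset.sum_const, Finset.card_univ, Fintype.card_fin, nsmul_eq_mul] at hsum
  linarith

end PolynomialFunctions

theorem statement13 (n : ℕ) (hn : 0 < n) (f : MvPolynomial (Fin n) ℝ)
    (d : ℕ) (hd0 : 0 < d) (hdeven : Even d) (hdeg : f.totalDegree ≤ d)
    (q : ℕ) (hqprime : q.Prime) (hqn : n < q)
    (hqsmall : ∀ p : ℕ, p.Prime → n < p → q ≤ p) :
    ∃ Q : MvPolynomial (Fin n × Fin n) ℝ, Q ≠ 0 ∧
      ∀ V : Matrix (Fin n) (Fin n) ℚ,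
        eval (fun ij => ((V ij.1 ij.2 : ℚ) : ℝ)) Q ≠ 0 →
          IsUnit V ∧
          ∀ P : Set (EuclideanSpace ℝ (Fin n)),
            (P = {x | eval (fun j => x j) (compMat V f) = 0} ∨
             P = {x | 0 < eval (fun j => x j) (compMat V f)} ∨
             P = {x | eval (fun j => x j) (compMat V f) < 0}) →
            ∀ x₀ ∈ P, ∀ z ∈ ZZ hn (connectedComponentIn P x₀), ∀ ε : ℝ, 0 < ε →
              ∃ t : ℝ, t ≠ 0 ∧ |t| < ε ∧
                ∃ w : EuclideanSpace ℝ (Fin n), dist w z < ε ∧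
                  eval (fun j => w j) (Fdef d q V f t) = 0 ∧
                  ∀ k : Fin n, k ≠ ⟨0, hn⟩ →
                    eval (fun j => w j) (pderiv k (Fdef d q V f t)) = 0 := by
  obtain ⟨Q, hQ, hQV⟩ := exists_generic_finite ⟨0, hn⟩ f
  refine ⟨Q, hQ, fun V hV => ⟨(hQV V hV).1, fun P hP x₀ hx₀ z hz ε hε => ?_⟩⟩
  have hfin := finite_nearCritical (hQV V hV).2
  have hne : (EuclideanSpace.proj ⟨0, hn⟩ : EuclideanSpace ℝ (Fin n) →L[ℝ] ℝ) ≠ 0 := fun h0 => by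
    simpa using DFunLike.congr_fun h0 (EuclideanSpace.single ⟨0, hn⟩ 1)
  have hgpos : ∀ x : EuclideanSpace ℝ (Fin n), 0 < eval (fun j => x j) (gPoly n d q) := fun x =>
    eval_gPoly_pos hdeven hqprime.pos _
  obtain ⟨s, hs0, hs, w, hw, hval, hder⟩ : ∃ s : ℝ, s ≠ 0 ∧ |s| < min (1 / 2) (ε / 2) ∧
      ∃ w : EuclideanSpace ℝ (Fin n), dist w z < min (1 / 2) (ε / 2) ∧
        eval (fun j => w j) (compMat V f) = s * eval (fun j => w j) (gPoly n d q) ∧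
        ∀ k : EuclideanSpace ℝ (Fin n), k ⟨0, hn⟩ = 0 →
          fderiv ℝ (fun x : EuclideanSpace ℝ (Fin n) => eval (fun j => x j) (compMat V f)) w k =
          s * fderiv ℝ (fun x : EuclideanSpace ℝ (Fin n) => eval (fun j => x j) (gPoly n d q)) w k
      := by
    have hε' : 0 < min (1 / 2) (ε / 2) := by positivity
    rcases hz with ⟨hzc, hb, hz0⟩ | ⟨hzc, hb, hz0⟩
    · exact exists_perturbed_critical (contDiff_eval _) (contDiff_eval _) hgpos hne hfin hP hx₀ hzc
        (fun x hx => hz0.trans_le (csInf_le hb (mem_image_of_mem _ hx))) hε'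
    · obtain ⟨s, hs0, hs, w, hw, hval, hder⟩ := exists_perturbed_critical
        (contDiff_eval (compMat V f)) (contDiff_eval _) hgpos (neg_ne_zero.mpr hne)
        (finite_nearCritical_neg hfin) hP hx₀ hzc
        (fun x hx => neg_le_neg ((le_csSup hb (mem_image_of_mem _ hx)).trans_eq hz0.symm)) hε'
      exact ⟨s, hs0, hs, w, hw, hval, fun k hk => hder k (neg_eq_zero.mpr hk)⟩
  rw [lt_min_iff] at hs hw
  have h1s : 1 / 2 < 1 - s := by linarith [(abs_lt.mp hs.1).2]
  have h1s0 : 1 - s ≠ 0 := by linarith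
  have hcancel : ∀ a b : ℝ, a = s * b → (1 - -s / (1 - s)) * a + -s / (1 - s) * b = 0 := by
    rintro a b rfl
    field_simp
    ring
  refine ⟨-s / (1 - s), div_ne_zero (neg_ne_zero.mpr hs0) h1s0, ?_, w, by linarith, ?_,
    fun k hk => ?_⟩
  · rw [abs_div, abs_neg, abs_of_pos (by linarith : 0 < 1 - s), div_lt_iff₀ (by linarith)]
    nlinarith
  · simpa only [Fdef, map_add, map_mul, eval_C] using hcancel _ _ hval
  · have hk' := hder (EuclideanSpace.single k 1) (by simp [Ne.symm hk])
    rw [fderiv_eval_single, fderiv_eval_single] at hk'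
    simpa only [Fdef, map_add, pderiv_C_mul, smul_eval, map_mul, eval_C] using hcancel _ _ hk'
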